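/- arXiv:2007.10863 — 5 statements merged into one kernel-verified Lean document; each statement's English description precedes it below -/
import Mathlib

section
/- Let n ≥ 1 and let c ∈ ℤ^n be such that the circulant matrix Cir(c) is invertible (over ℝ), and set k = ∑_i c_i. Then c is a core point for the cyclic group C_n = ⟨σ⟩ if and only if for every z ∈ ℤ^n with ∑_i z_i = k that is not a cyclic shift of c (i.e., z ∉ {σ^i(c) : 0 ≤ i < n}), at least one entry of the vector Cir(c)^{−1}·z is strictly negative. -/
open Finset Matrix

/-- The circulant matrix of `c`: its `(j,k)` entry is `c ((j - k) mod n)`;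
its columns are exactly the `n` cyclic shifts `σ^k(c)` of `c`. -/
def CirR {n : ℕ} (c : Fin n → ℝ) : Matrix (Fin n) (Fin n) ℝ :=
  Matrix.of fun j k => c (j - k)

/-- The convex hull of the columns of `A` is the image of the standard simplex under `A`. -/
theorem convexHull_range_col {m ι : Type*} [Fintype ι] [DecidableEq ι]
    (A : Matrix m ι ℝ) :
    convexHull ℝ (Set.range A.col) = A.mulVecLin '' stdSimplex ℝ ι := by
  rw [← convexHull_basis_eq_stdSimplex, LinearMap.image_convexHull, ← Set.range_comp]
  congr 2
  ext j i
  simp [Matrix.mulVec, dotProduct]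

theorem sum_mulVec_of_col_sum {m ι : Type*} [Fintype m] [Fintype ι] (A : Matrix m ι ℝ) {k : ℝ}
    (hA : ∀ j, ∑ i, A i j = k) (w : ι → ℝ) : ∑ i, (A *ᵥ w) i = k * ∑ j, w j := by
  simp only [Matrix.mulVec, dotProduct]
  rw [Finset.sum_comm]
  simp_rw [← Finset.sum_mul, hA, Finset.mul_sum]

/-- Membership in the convex hull of the columns of an invertible matrix whose columns all have
the same sum. -/
theorem mem_convexHull_range_col_iff {ι : Type*} [Fintype ι] [DecidableEq ι] [Nonempty ι]
    {A : Matrix ι ι ℝ} (h : IsUnit A) {k : ℝ} (hA : ∀ j, ∑ i, A i j = k) (z : ι → ℝ) :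
    z ∈ convexHull ℝ (Set.range A.col) ↔ ∑ i, z i = k ∧ ∀ i, 0 ≤ (A⁻¹ *ᵥ z) i := by
  have hdet := (Matrix.isUnit_iff_isUnit_det A).1 h
  have hAz : A *ᵥ (A⁻¹ *ᵥ z) = z := by
    rw [Matrix.mulVec_mulVec, Matrix.mul_nonsing_inv A hdet, Matrix.one_mulVec]
  rw [convexHull_range_col]
  constructor
  · rintro ⟨w, ⟨hw, hw1⟩, rfl⟩
    refine ⟨by simp [sum_mulVec_of_col_sum A hA, hw1], fun i => ?_⟩
    rw [Matrix.mulVecLin_apply, Matrix.mulVec_mulVec, Matrix.nonsing_inv_mul A hdet,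
      Matrix.one_mulVec]
    exact hw i
  · rintro ⟨hz, hpos⟩
    refine ⟨A⁻¹ *ᵥ z, ⟨hpos, ?_⟩, hAz⟩
    have hk : k ≠ 0 := by
      rintro rfl
      obtain ⟨i⟩ := ‹Nonempty ι›
      have h1 := sum_mulVec_of_col_sum A hA (A⁻¹ *ᵥ Pi.single i 1)
      rw [Matrix.mulVec_mulVec, Matrix.mul_nonsing_inv A hdet, Matrix.one_mulVec] at h1
      simp at h1
    have h1 := sum_mulVec_of_col_sum A hA (A⁻¹ *ᵥ z)
    rw [hAz, hz] at h1
    exact mul_left_cancel₀ hk (by rw [← h1, mul_one])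

theorem sum_CirR_col {n : ℕ} (c : Fin n → ℝ) (j : Fin n) : ∑ i, CirR c i j = ∑ i, c i := by
  cases n with
  | zero => exact j.elim0
  | succ m => exact (Equiv.subRight j).sum_comp c

/-- Let `c ∈ ℤⁿ` with `Cir(c)` invertible over ℝ, and `k = ∑ᵢ cᵢ`.  Then `c` is a
core point for the cyclic group `Cₙ = ⟨σ⟩` (i.e. the only integer points of the
orbit polytope `conv{σ^j(c)}` are the cyclic shifts of `c`) if and only if for every
integer point `z` in the layer `k` that is not a cyclic shift of `c`, some entry of
`Cir(c)⁻¹ · z` is strictly negative. -/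
theorem stmt7 {n : ℕ} (hn : 1 ≤ n) (c : Fin n → ℤ)
    (h : IsUnit (CirR fun i => (c i : ℝ))) :
    (∀ z : Fin n → ℤ,
        (fun i => (z i : ℝ)) ∈
            convexHull ℝ {x : Fin n → ℝ | ∃ j : Fin n, x = fun i => ((c (i - j) : ℤ) : ℝ)} →
          ∃ j : Fin n, z = fun i => c (i - j)) ↔
      (∀ z : Fin n → ℤ, (∑ i, z i) = (∑ i, c i) →
        (¬ ∃ j : Fin n, z = fun i => c (i - j)) →
          ∃ i : Fin n, ((CirR fun i => (c i : ℝ))⁻¹ *ᵥ fun i => (z i : ℝ)) i < 0) := by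
  have : Nonempty (Fin n) := ⟨⟨0, hn⟩⟩
  have hset : {x : Fin n → ℝ | ∃ j : Fin n, x = fun i => ((c (i - j) : ℤ) : ℝ)} =
      Set.range (CirR fun i => (c i : ℝ)).col := by
    ext x
    exact ⟨fun ⟨j, hj⟩ => ⟨j, hj.symm⟩, fun ⟨j, hj⟩ => ⟨j, hj.symm⟩⟩
  have hmem := mem_convexHull_range_col_iff h (sum_CirR_col _)
  rw [hset]
  simp only [hmem]
  refine forall_congr' fun z => ?_
  have hsum : ∑ i, (z i : ℝ) = ∑ i, (c i : ℝ) ↔ ∑ i, z i = ∑ i, c i := by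
    exact_mod_cast Iff.rfl
  rw [hsum, and_imp]
  refine imp_congr_right fun _ => ?_
  rw [← not_imp_not]
  simp only [not_forall, not_le]
end

section
/- Let n ≥ 1, let c ∈ ℝ^n satisfy ψ_m(c) ≠ 0 for m = 1,…,n−1 and ∑_i c_i ≠ 0, let k ∈ ℤ with ∑_i c_i + kn ≠ 0, and set c′ = c + k·𝟏. Let z ∈ ℝ^n satisfy ∑_i z_i = ∑_i c_i and set z′ = z + k·𝟏. Then ⟨z, T̄(c)⟩ = ⟨z′, T̄(c′)⟩, where T̄(c) ∈ ℝ^n denotes the first row of the circulant matrix Cir(v) of the vector v with entries v_k = (1/n)·(ψ_0(c)^{−1} + T_k(c)), i.e., T̄(c)_j = (1/n)·(ψ_0(c)^{−1} + T_{(n−j) mod n}(c)). -/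
open Finset

/-- `ζ = exp(2πi/n)`. -/
noncomputable def zeta (n : ℕ) : ℂ :=
  Complex.exp (2 * (Real.pi : ℂ) * Complex.I / (n : ℂ))

/-- `ψ_m(c) = ∑_j c_j ζ^{jm}`; note `ψ_0(c) = ∑_j c_j`. -/
noncomputable def psi {n : ℕ} (c : Fin n → ℂ) (m : Fin n) : ℂ :=
  ∑ j : Fin n, c j * zeta n ^ ((j : ℕ) * (m : ℕ))

/-- `T_k(c) = ∑_{m=1}^{n-1} ζ^{km} ψ_m(c)⁻¹`. -/
noncomputable def T {n : ℕ} (c : Fin n → ℂ) (k : Fin n) : ℂ :=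
  ∑ m ∈ Finset.univ.filter (fun m : Fin n => (m : ℕ) ≠ 0),
    zeta n ^ ((k : ℕ) * (m : ℕ)) * (psi c m)⁻¹

/-- The `j`-th entry of `T̄(c)`, the first row of `Cir(v)` where
`v_k = (1/n)(ψ_0(c)⁻¹ + T_k(c))`: namely `T̄(c)_j = (1/n)(ψ_0(c)⁻¹ + T_{(n-j) mod n}(c))`. -/
noncomputable def Tbar {n : ℕ} (hn : 1 ≤ n) (c : Fin n → ℂ) (j : Fin n) : ℂ :=
  (1 / (n : ℂ)) * ((psi c ⟨0, hn⟩)⁻¹ + T c (-j))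

theorem zeta_isPrimitiveRoot {n : ℕ} (hn : n ≠ 0) : IsPrimitiveRoot (zeta n) n :=
  Complex.isPrimitiveRoot_exp n hn

theorem sum_zeta_pow_eq_zero {n : ℕ} (m : Fin n) (hm : (m : ℕ) ≠ 0) :
    ∑ j : Fin n, zeta n ^ ((j : ℕ) * (m : ℕ)) = 0 := by
  have hζ := zeta_isPrimitiveRoot (n := n) (by have := m.isLt; omega)
  have hne : zeta n ^ (m : ℕ) ≠ 1 := hζ.pow_ne_one_of_pos_of_lt hm m.isLt
  have hgeom := mul_geom_sum (zeta n ^ (m : ℕ)) n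
  rw [← pow_mul, mul_comm (m : ℕ) n, pow_mul, hζ.pow_eq_one, one_pow, sub_self] at hgeom
  rw [Fin.sum_univ_eq_sum_range (fun j => zeta n ^ (j * (m : ℕ))) n]
  simpa only [mul_comm _ (m : ℕ), pow_mul] using
    (mul_eq_zero.mp hgeom).resolve_left (sub_ne_zero.mpr hne)

theorem psi_zero {n : ℕ} (hn : 0 < n) (c : Fin n → ℂ) : psi c ⟨0, hn⟩ = ∑ j, c j := by
  simp [psi]

theorem psi_add_const {n : ℕ} (c : Fin n → ℂ) (a : ℂ) (m : Fin n) (hm : (m : ℕ) ≠ 0) :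
    psi (fun j => c j + a) m = psi c m := by
  simp only [psi, add_mul, sum_add_distrib, ← mul_sum, sum_zeta_pow_eq_zero m hm, mul_zero,
    add_zero]

theorem T_add_const {n : ℕ} (c : Fin n → ℂ) (a : ℂ) : T (fun j => c j + a) = T c := by
  funext k
  refine sum_congr rfl fun m hm => ?_
  rw [psi_add_const c a m (mem_filter.mp hm).2]

theorem sum_T_eq_zero {n : ℕ} (c : Fin n → ℂ) : ∑ j, T c j = 0 := by
  simp only [T]
  rw [sum_comm]
  refine sum_eq_zero fun m hm => ?_
  rw [← sum_mul, sum_zeta_pow_eq_zero m (mem_filter.mp hm).2, zero_mul]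

theorem sum_T_neg_eq_zero {n : ℕ} (c : Fin n → ℂ) : ∑ j, T c (-j) = 0 := by
  cases n with
  | zero => simp
  | succ n => exact (Equiv.sum_comp (Equiv.neg (Fin (n + 1))) (T c)).trans (sum_T_eq_zero c)

theorem sum_mul_Tbar {n : ℕ} (hn : 1 ≤ n) (c z : Fin n → ℂ) (hc : ∑ i, c i ≠ 0)
    (hz : ∑ i, z i = ∑ i, c i) :
    ∑ j, z j * Tbar hn c j = (n : ℂ)⁻¹ * (1 + ∑ j, z j * T c (-j)) := by
  have hcancel : ∑ j, z j * (psi c ⟨0, hn⟩)⁻¹ = 1 := by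
    rw [← sum_mul, psi_zero, hz, mul_inv_cancel₀ hc]
  rw [← hcancel, ← sum_add_distrib, mul_sum]
  refine sum_congr rfl fun j _ => ?_
  rw [Tbar]
  ring

/-- The inequality data `⟨z, T̄(c)⟩` is invariant under translation along the fixed
space: if `c' = c + k·𝟏` and `z' = z + k·𝟏` with `z` in the same layer as `c`
(and both layers nonzero), then `⟨z, T̄(c)⟩ = ⟨z', T̄(c')⟩`. -/
theorem stmt11 {n : ℕ} (hn : 1 ≤ n) (c : Fin n → ℝ)
    (h : ∀ m : Fin n, (m : ℕ) ≠ 0 → psi (fun j => (c j : ℂ)) m ≠ 0)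
    (hc0 : (∑ i, c i) ≠ 0) (k : ℤ) (hk : (∑ i, c i) + (k : ℝ) * n ≠ 0)
    (z : Fin n → ℝ) (hz : ∑ i, z i = ∑ i, c i) :
    ∑ j : Fin n, (z j : ℂ) * Tbar hn (fun i => (c i : ℂ)) j =
      ∑ j : Fin n, ((z j + (k : ℝ) : ℝ) : ℂ) * Tbar hn (fun i => ((c i + (k : ℝ) : ℝ) : ℂ)) j := by
  have hzC : ∑ i, (z i : ℂ) = ∑ i, (c i : ℂ) := by exact_mod_cast hz
  have hcC : ∑ i, (c i : ℂ) ≠ 0 := by exact_mod_cast hc0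
  have hkC : ∑ i, ((c i : ℂ) + (k : ℂ)) ≠ 0 := by
    rw [sum_add_distrib, sum_const, card_univ, Fintype.card_fin, nsmul_eq_mul, mul_comm]
    exact_mod_cast hk
  simp only [Complex.ofReal_add, Complex.ofReal_intCast]
  rw [sum_mul_Tbar hn _ _ hcC hzC,
    sum_mul_Tbar hn _ (fun i => (z i : ℂ) + (k : ℂ)) hkC (by simp only [sum_add_distrib, hzC]),
    T_add_const]
  simp only [add_mul, sum_add_distrib, ← mul_sum, sum_T_neg_eq_zero, mul_zero, add_zero]
end

section
/- Let ι be a finite index set, let (α_i)_{i∈ι} be finite types, let G_i be a group of permutations of α_i for each i, and let the product group G = ∏_i G_i act on functions x : (Σ_{i∈ι} α_i) → ℝ blockwise: ((g_i)_i · x)(i,a) = x(i, g_i^{−1}(a)). Then for every z : (Σ_i α_i) → ℝ and every x, the point x lies in the convex hull of the G-orbit of z if and only if for every i ∈ ι the restriction x(i,·) : α_i → ℝ lies in the convex hull of the G_i-orbit of z(i,·). In other words, conv(G·z) is the Cartesian product over i of the orbit polytopes conv(G_i · z(i,·)). -/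
open Finset

/-- For a direct product `G = ∏ᵢ Gᵢ` of permutation groups acting blockwise on
`(Σ i, αᵢ) → ℝ` by `((gᵢ)ᵢ · x)(i,a) = x(i, gᵢ⁻¹ a)`, a point `x` lies in the orbit
polytope `conv(G·z)` if and only if for each block `i` the restriction `x(i,·)` lies in
the orbit polytope `conv(Gᵢ · z(i,·))`; i.e. `conv(G·z)` is the Cartesian product of
the blockwise orbit polytopes. -/
theorem stmt15 {ι : Type*} [Fintype ι] {α : ι → Type*} [∀ i, Fintype (α i)]
    (G : ∀ i, Subgroup (Equiv.Perm (α i))) (z x : (Σ i, α i) → ℝ) :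
    (x ∈ convexHull ℝ
        {y : (Σ i, α i) → ℝ | ∃ g : ∀ i, Equiv.Perm (α i),
          (∀ i, g i ∈ G i) ∧ y = fun p => z ⟨p.1, (g p.1)⁻¹ p.2⟩}) ↔
      ∀ i, (fun a => x ⟨i, a⟩) ∈
        convexHull ℝ {y : α i → ℝ | ∃ g ∈ G i, y = fun a => z ⟨i, g⁻¹ a⟩} := by
  let L := LinearEquiv.piCurry ℝ fun (i : ι) (_ : α i) ↦ ℝ
  let t : ∀ i, Set (α i → ℝ) := fun i ↦ {y | ∃ g ∈ G i, y = fun a ↦ z ⟨i, g⁻¹ a⟩}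
  have horbit : {y : (Σ i, α i) → ℝ | ∃ g : ∀ i, Equiv.Perm (α i),
      (∀ i, g i ∈ G i) ∧ y = fun p ↦ z ⟨p.1, (g p.1)⁻¹ p.2⟩} =
      L.symm '' Set.univ.pi t := by
    ext y
    rw [LinearEquiv.image_symm_eq_preimage]
    constructor
    · rintro ⟨g, hg, rfl⟩ i -
      exact ⟨g i, hg i, rfl⟩
    · intro hy
      choose g hg hgy using fun i ↦ hy i (Set.mem_univ i)
      exact ⟨g, hg, funext fun p ↦ congrFun (hgy p.1) p.2⟩
  have himage := L.symm.toLinearMap.image_convexHull (Set.univ.pi t)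
  rw [LinearEquiv.coe_coe] at himage
  rw [horbit, ← himage, convexHull_pi, LinearEquiv.image_symm_eq_preimage]
  exact Set.mem_univ_pi
end

section
/- Let ι be a finite index set, let (α_i)_{i∈ι} be finite types, let G_i be a group of permutations of α_i for each i, and let the product group G = ∏_i G_i act on functions x : (Σ_{i∈ι} α_i) → ℝ blockwise: ((g_i)_i · x)(i,a) = x(i, g_i^{−1}(a)). Then an integer point z : (Σ_i α_i) → ℤ is a core point for G if and only if for every i ∈ ι the restriction z(i,·) : α_i → ℤ is a core point for G_i. Equivalently, core(G) = ∏_i core(G_i). -/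
open Finset

/-- `z ∈ ℤ^β` is a core point for the permutation group `H ≤ Perm β`: the only integer
points of the orbit polytope `conv(H·z)` are the points of the `H`-orbit of `z`. -/
def IsCorePoint {β : Type*} [Fintype β] (H : Subgroup (Equiv.Perm β)) (z : β → ℤ) : Prop :=
  ∀ w : β → ℤ,
    ((fun b => (w b : ℝ)) ∈
        convexHull ℝ {y : β → ℝ | ∃ g ∈ H, y = fun b => ((z (g⁻¹ b) : ℤ) : ℝ)}) →
      ∃ g ∈ H, w = fun b => z (g⁻¹ b)

/-- The orbit polytope of a product group is the product of the orbit polytopes of the factors: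
membership can be tested blockwise. -/
theorem mem_convexHull_sigma_orbit_iff {ι : Type*} [Fintype ι] {α : ι → Type*}
    (G : ∀ i, Subgroup (Equiv.Perm (α i))) (z : (Σ i, α i) → ℤ) (x : (Σ i, α i) → ℝ) :
    x ∈ convexHull ℝ
        {y : (Σ i, α i) → ℝ | ∃ g : ∀ i, Equiv.Perm (α i),
          (∀ i, g i ∈ G i) ∧ y = fun p => ((z ⟨p.1, (g p.1)⁻¹ p.2⟩ : ℤ) : ℝ)} ↔
      ∀ i, (fun a => x ⟨i, a⟩) ∈ convexHull ℝ
        {y : α i → ℝ | ∃ g ∈ G i, y = fun a => ((z ⟨i, g⁻¹ a⟩ : ℤ) : ℝ)} := by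
  let e := LinearEquiv.piCurry ℝ (fun (i : ι) (_ : α i) => ℝ)
  have himage : e '' {y : (Σ i, α i) → ℝ | ∃ g : ∀ i, Equiv.Perm (α i),
        (∀ i, g i ∈ G i) ∧ y = fun p => ((z ⟨p.1, (g p.1)⁻¹ p.2⟩ : ℤ) : ℝ)} =
      Set.univ.pi fun i =>
        {y : α i → ℝ | ∃ g ∈ G i, y = fun a => ((z ⟨i, g⁻¹ a⟩ : ℤ) : ℝ)} := by
    ext y
    constructor
    · rintro ⟨_, ⟨g, hg, rfl⟩, rfl⟩ i -
      exact ⟨g i, hg i, rfl⟩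
    · intro hy
      choose g hg hyg using fun i => hy i (Set.mem_univ i)
      exact ⟨_, ⟨g, hg, rfl⟩, funext fun i => (hyg i).symm⟩
  have hconv := e.toLinearMap.image_convexHull {y : (Σ i, α i) → ℝ |
    ∃ g : ∀ i, Equiv.Perm (α i),
      (∀ i, g i ∈ G i) ∧ y = fun p => ((z ⟨p.1, (g p.1)⁻¹ p.2⟩ : ℤ) : ℝ)}
  rw [LinearEquiv.coe_coe, himage, convexHull_pi] at hconv
  rw [← e.injective.mem_set_image, hconv, Set.mem_univ_pi]
  rfl

/-- For a direct product `G = ∏ᵢ Gᵢ` of permutation groups acting blockwise on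
`(Σ i, αᵢ) → ℝ`, an integer point `z` is a core point for `G` if and only if each
restriction `z(i,·)` is a core point for `Gᵢ`; i.e. `core(G) = ∏ᵢ core(Gᵢ)`. -/
theorem stmt16 {ι : Type*} [Fintype ι] {α : ι → Type*} [∀ i, Fintype (α i)]
    (G : ∀ i, Subgroup (Equiv.Perm (α i))) (z : (Σ i, α i) → ℤ) :
    (∀ w : (Σ i, α i) → ℤ,
        ((fun p => (w p : ℝ)) ∈
            convexHull ℝ
              {y : (Σ i, α i) → ℝ | ∃ g : ∀ i, Equiv.Perm (α i),
                (∀ i, g i ∈ G i) ∧ y = fun p => ((z ⟨p.1, (g p.1)⁻¹ p.2⟩ : ℤ) : ℝ)}) →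
          ∃ g : ∀ i, Equiv.Perm (α i),
            (∀ i, g i ∈ G i) ∧ w = fun p => z ⟨p.1, (g p.1)⁻¹ p.2⟩) ↔
      ∀ i, IsCorePoint (G i) (fun a => z ⟨i, a⟩) := by
  classical
  simp only [mem_convexHull_sigma_orbit_iff]
  constructor
  · intro h i w hw
    let v : ∀ j, α j → ℤ := Function.update (fun j a => z ⟨j, a⟩) i w
    have hv : v i = w := Function.update_self ..
    obtain ⟨g, hg, hvg⟩ := h (fun p => v p.1 p.2) fun j => by
      by_cases hj : j = i
      · subst hj
        simpa only [hv] using hw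
      · exact subset_convexHull ℝ _ ⟨1, one_mem _, by simp [v, hj]⟩
    exact ⟨g i, hg i, hv ▸ funext fun a => congrFun hvg ⟨i, a⟩⟩
  · intro h w hw
    choose g hg hwg using fun i => h i (fun a => w ⟨i, a⟩) (hw i)
    exact ⟨g, hg, funext fun p => congrFun (hwg p.1) p.2⟩
end

section
/- Let n be odd and c ∈ ℝ^n. Then det(Cir(c)) = ⟨V_0,c⟩ · ∏_{m=1}^{(n−1)/2} ( ⟨V_m,c⟩² + ⟨U_m,c⟩² ), where ⟨V_0,c⟩ = ∑_j c_j. -/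
open Finset

/-- The discrete Fourier transform diagonalizes a circulant matrix. -/
theorem Matrix.det_circulant_eq_prod_of_isPrimitiveRoot {K : Type*} [Field K] {n : ℕ} {ζ : K}
    (hζ : IsPrimitiveRoot ζ n) (c : Fin n → K) :
    (Matrix.circulant c).det = ∏ m ∈ Finset.range n, ∑ j : Fin n, ζ ^ (m * (j : ℕ)) * c j := by
  rcases Nat.eq_zero_or_pos n with rfl | hn
  · simp
  have : NeZero n := ⟨hn.ne'⟩
  set W : Matrix (Fin n) (Fin n) K := Matrix.vandermonde fun i : Fin n => ζ ^ (i : ℕ) with hW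
  have hdet : W.det ≠ 0 := by
    rw [hW, Matrix.det_vandermonde_ne_zero_iff]
    exact fun a b hab => Fin.ext (hζ.pow_inj a.2 b.2 hab)
  have hpow (i a b : Fin n) :
      (ζ ^ (i : ℕ)) ^ ((a + b : Fin n) : ℕ) = (ζ ^ (i : ℕ)) ^ ((a : ℕ) + b) := by
    rw [Fin.val_add]
    refine (pow_eq_pow_mod _ ?_).symm
    rw [← pow_mul, mul_comm, pow_mul, hζ.pow_eq_one, one_pow]
  have hmul : W * Matrix.circulant c =
      Matrix.diagonal (fun i : Fin n => ∑ j : Fin n, ζ ^ ((i : ℕ) * (j : ℕ)) * c j) * W := by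
    ext i k
    rw [Matrix.mul_apply, Matrix.diagonal_mul, ← Equiv.sum_comp (Equiv.addRight k),
      Finset.sum_mul]
    refine Finset.sum_congr rfl fun j _ => ?_
    simp only [hW, Matrix.vandermonde_apply, Equiv.coe_addRight, Matrix.circulant_apply,
      add_sub_cancel_right, hpow, pow_add, pow_mul]
    ring
  have h := congrArg Matrix.det hmul
  rw [Matrix.det_mul, Matrix.det_mul, Matrix.det_diagonal, mul_comm] at h
  rw [mul_right_cancel₀ hdet h,
    Fin.prod_univ_eq_prod_range (fun m => ∑ j : Fin n, ζ ^ (m * (j : ℕ)) * c j) n]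

/-- A product over an odd range, with `m` paired with its reflection. -/
theorem Finset.prod_range_odd {M : Type*} [CommMonoid M] {n k : ℕ}
    (hn : n = 2 * k + 1) (f : ℕ → M) :
    ∏ i ∈ Finset.range n, f i =
      f 0 * ∏ m ∈ Finset.Icc 1 k, (f m * f (n - m)) := by
  subst hn
  have hIcc : Finset.Icc 1 k = Finset.Ico 1 (k + 1) := by ext; simp
  rw [Finset.prod_range_succ', mul_comm, two_mul, Finset.prod_range_add, hIcc,
    Finset.prod_Ico_eq_prod_range, Finset.prod_mul_distrib, Nat.add_sub_cancel,
    ← Finset.prod_range_reflect (fun x => f (k + x + 1))]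
  congr 2
  · exact Finset.prod_congr rfl fun i _ => by rw [add_comm]
  · refine Finset.prod_congr rfl fun i hi => ?_
    have := Finset.mem_range.mp hi
    congr 1
    omega

/-- For odd `n`,
`det(Cir(c)) = ⟨V₀,c⟩ · ∏_{m=1}^{(n-1)/2} (⟨V_m,c⟩² + ⟨U_m,c⟩²)`, where
`V_m = (cos(2πjm/n))_j`, `U_m = (sin(2πjm/n))_j` and `⟨V₀,c⟩ = ∑_j c_j`. -/
theorem stmt18 {n : ℕ} (hodd : Odd n) (c : Fin n → ℝ) :
    (CirR c).det =
      (∑ j, c j) *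
        ∏ m ∈ Finset.Icc 1 ((n - 1) / 2),
          ((∑ j : Fin n, Real.cos (2 * Real.pi * ((j : ℕ) : ℝ) * (m : ℝ) / (n : ℝ)) * c j) ^ 2 +
           (∑ j : Fin n, Real.sin (2 * Real.pi * ((j : ℕ) : ℝ) * (m : ℝ) / (n : ℝ)) * c j) ^ 2) := by
  obtain ⟨k, hn⟩ := hodd
  have hn0 : n ≠ 0 := by omega
  have hk : (n - 1) / 2 = k := by omega
  set ζ : ℂ := Complex.exp (2 * Real.pi * Complex.I / n) with hζdef
  have hζ : IsPrimitiveRoot ζ n := Complex.isPrimitiveRoot_exp n hn0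
  have hconj : (starRingEnd ℂ) ζ = ζ⁻¹ := by
    rw [hζdef, ← Complex.exp_conj, ← Complex.exp_neg]
    congr 1
    simp [neg_div, map_ofNat (starRingEnd ℂ)]
  have hpow (m j : ℕ) : ζ ^ (m * j) =
      Real.cos (2 * Real.pi * j * m / n) + Real.sin (2 * Real.pi * j * m / n) * Complex.I := by
    rw [hζdef, ← Complex.exp_nat_mul, Complex.ofReal_cos, Complex.ofReal_sin,
      ← Complex.exp_mul_I]
    congr 1
    push_cast
    ring
  set f : ℕ → ℂ := fun m => ∑ j : Fin n, ζ ^ (m * (j : ℕ)) * (c j : ℂ) with hf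
  have hrefl (m : ℕ) (hm : m ≤ n) : f (n - m) = (starRingEnd ℂ) (f m) := by
    simp only [hf, map_sum, map_mul, map_pow, hconj, Complex.conj_ofReal]
    refine Finset.sum_congr rfl fun j _ => ?_
    rw [pow_mul, pow_mul, pow_sub₀ ζ (hζ.ne_zero hn0) hm, hζ.pow_eq_one, one_mul, inv_pow, inv_pow,
      inv_pow]
  have hfm (m : ℕ) : f m =
      ((∑ j : Fin n, Real.cos (2 * Real.pi * ((j : ℕ) : ℝ) * (m : ℝ) / (n : ℝ)) * c j : ℝ) : ℂ) +
      ((∑ j : Fin n, Real.sin (2 * Real.pi * ((j : ℕ) : ℝ) * (m : ℝ) / (n : ℝ)) * c j : ℝ) : ℂ) *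
        Complex.I := by
    simp only [hf, hpow, Complex.ofReal_sum, Complex.ofReal_mul, Finset.sum_mul,
      ← Finset.sum_add_distrib]
    exact Finset.sum_congr rfl fun j _ => by ring
  have hdet : ((CirR c).det : ℂ) = (Matrix.circulant fun j => (c j : ℂ)).det :=
    Complex.ofRealHom.map_det (CirR c)
  apply Complex.ofReal_injective
  rw [hdet, Matrix.det_circulant_eq_prod_of_isPrimitiveRoot hζ,
    Finset.prod_range_odd hn f, hk, Complex.ofReal_mul, Complex.ofReal_prod]
  congr 1
  · simp [hf]
  · refine Finset.prod_congr rfl fun m hm => ?_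
    rw [hrefl m (by have := (Finset.mem_Icc.mp hm).2; omega), Complex.mul_conj, hfm,
      Complex.normSq_add_mul_I]
end
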